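/- Let A be an MPS tensor that is injective with injectivity length L and admits positive definite transfer fixed points ρ_L, ρ_R. Let o be a k-site operator (k ≥ 1), let N > 2L + 2k − 1, and suppose O_N ψ_N = (N·ε) ψ_N for some ε ∈ ℂ. Then the local expectation value of o in the fixed-point environment equals ε; explicitly, Σ_{(i_1,…,i_k), (j_1,…,j_k) ∈ (Fin d)^k} o^{i_1…i_k}_{j_1…j_k} · Tr( ρ_L A^{j_1}⋯A^{j_k} ρ_R (A^{i_k})† ⋯ (A^{i_1})† ) = ε · Tr(ρ_L ρ_R). -/

import Mathlib

open Matrix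
open scoped ComplexOrder

/-- Cyclic shift of a site index: `cyc a t` is `a + t (mod N)`. -/
def cyc {N : ℕ} (a : Fin N) (t : ℕ) : Fin N :=
  ⟨(a.val + t) % N, Nat.mod_lt _ (Nat.lt_of_le_of_lt (Nat.zero_le _) a.isLt)⟩

/-- Ordered product `A^{i_1} ⋯ A^{i_m}`. -/
noncomputable def prodA {d D m : ℕ} (A : Fin d → Matrix (Fin D) (Fin D) ℂ)
    (i : Fin m → Fin d) : Matrix (Fin D) (Fin D) ℂ :=
  (List.ofFn fun t => A (i t)).prod

/-- Matrix product state on `N` cyclic sites: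
`ψ_N(i_1,…,i_N) = Tr(A^{i_1} ⋯ A^{i_N})`. -/
noncomputable def mps {d D : ℕ} (A : Fin d → Matrix (Fin D) (Fin D) ℂ) (N : ℕ) :
    (Fin N → Fin d) → ℂ :=
  fun i => (prodA A i).trace

/-- A `k`-site operator `o` acting on sites `n, n+1, …, n+k-1 (mod N)` of a
periodic chain of `N` sites, as a matrix on the full configuration space. -/
noncomputable def localOp {d k N : ℕ}
    (o : Matrix (Fin k → Fin d) (Fin k → Fin d) ℂ) (n : Fin N) :
    Matrix (Fin N → Fin d) (Fin N → Fin d) ℂ :=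
  Matrix.of fun x y =>
    o (fun t => x (cyc n t.val)) (fun t => y (cyc n t.val)) *
      (if ∀ m : Fin N, (∀ t : Fin k, m ≠ cyc n t.val) → x m = y m then 1 else 0)

/-- `O_N = Σ_{n=1}^N o_n`, the sum of all translates of a `k`-site operator. -/
noncomputable def opSum {d k N : ℕ}
    (o : Matrix (Fin k → Fin d) (Fin k → Fin d) ℂ) :
    Matrix (Fin N → Fin d) (Fin N → Fin d) ℂ :=
  ∑ n : Fin N, localOp o n

/-- `A` is injective with injectivity length `L`: the map
`Γ_L : X ↦ (Tr(X A^{i_1} ⋯ A^{i_L}))_{i}` is injective. -/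
noncomputable def InjectiveLen {d D : ℕ} (A : Fin d → Matrix (Fin D) (Fin D) ℂ)
    (L : ℕ) : Prop :=
  Function.Injective fun X : Matrix (Fin D) (Fin D) ℂ =>
    fun i : Fin L → Fin d => (X * prodA A i).trace

/-- `ρL, ρR` are positive definite fixed points of the transfer operator of `A`. -/
def TransferFixedPoints {d D : ℕ} (A : Fin d → Matrix (Fin D) (Fin D) ℂ)
    (ρL ρR : Matrix (Fin D) (Fin D) ℂ) : Prop :=
  ρL.PosDef ∧ ρR.PosDef ∧
    (∑ i, (A i)ᴴ * ρL * A i) = ρL ∧ (∑ i, A i * ρR * (A i)ᴴ) = ρR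

/-- `B` satisfies the local telescoping equation for `(A, o, ε)`, where `o` is a
`(k+1)`-site operator and `B` is a family of matrices indexed by `k`-tuples:
`Σ_j o^{i}_{j} A^{j_0}⋯A^{j_k} − ε A^{i_0}⋯A^{i_k}
  = A^{i_0} B^{i_1…i_k} − B^{i_0…i_{k-1}} A^{i_k}`. -/
noncomputable def Telescopes {d D k : ℕ} (A : Fin d → Matrix (Fin D) (Fin D) ℂ)
    (o : Matrix (Fin (k+1) → Fin d) (Fin (k+1) → Fin d) ℂ) (ε : ℂ)
    (B : (Fin k → Fin d) → Matrix (Fin D) (Fin D) ℂ) : Prop :=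
  ∀ i : Fin (k+1) → Fin d,
    (∑ j : Fin (k+1) → Fin d, o i j • prodA A j) - ε • prodA A i
      = A (i 0) * B (fun t => i t.succ) - B (fun t => i t.castSucc) * A (i (Fin.last k))
section Words

variable {ι n : Type*} [Fintype n] [DecidableEq n]

/-- The product of the matrices of `A` along a word. -/
noncomputable def wordProd (A : ι → Matrix n n ℂ) (w : List ι) : Matrix n n ℂ :=
  (w.map A).prod

@[simp] theorem wordProd_nil (A : ι → Matrix n n ℂ) : wordProd A [] = 1 := by
  simp [wordProd]

@[simp] theorem wordProd_cons (A : ι → Matrix n n ℂ) (x : ι) (w : List ι) :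
    wordProd A (x :: w) = A x * wordProd A w := by
  simp [wordProd]

@[simp] theorem wordProd_append (A : ι → Matrix n n ℂ) (v w : List ι) :
    wordProd A (v ++ w) = wordProd A v * wordProd A w := by
  simp [wordProd]

theorem prodA_eq_wordProd {d D m : ℕ} (A : Fin d → Matrix (Fin D) (Fin D) ℂ)
    (i : Fin m → Fin d) : prodA A i = wordProd A (List.ofFn i) := by
  simp [prodA, wordProd, List.map_ofFn, Function.comp_def]

/-- Every derivation of a full matrix algebra is inner. -/
theorem exists_eq_commutator_of_leibniz (β : Matrix n n ℂ →ₗ[ℂ] Matrix n n ℂ)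
    (hβ : ∀ X Y, β (X * Y) = β X * Y + X * β Y) :
    ∃ B, ∀ X, β X = X * B - B * X := by
  rcases isEmpty_or_nonempty n with hn | ⟨⟨r⟩⟩
  · exact ⟨0, fun X => Subsingleton.elim _ _⟩
  refine ⟨-∑ s, β (single s r 1) * single r s 1, fun X => ?_⟩
  have hone : ∑ s, single s r (1 : ℂ) * single r s 1 = (1 : Matrix n n ℂ) := by
    simp [Matrix.sum_single_one]
  have hexp : ∀ s, X * single s r 1 = ∑ t, X t s • single t r (1 : ℂ) := by
    intro s
    ext a b
    by_cases h : r = b <;> simp [Matrix.mul_apply, Matrix.single_apply, Matrix.sum_apply, h]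
  have hrow : ∀ t, single r t 1 * X = ∑ s, X t s • single r s (1 : ℂ) := by
    intro s
    ext a b
    by_cases h : r = a <;> simp [Matrix.mul_apply, Matrix.single_apply, Matrix.sum_apply, h]
  have hX : β X = ∑ s, β X * (single s r 1 * single r s 1) := by
    rw [← Finset.mul_sum, hone, mul_one]
  have hterm : ∀ s, β X * (single s r 1 * single r s 1)
      = β (X * single s r 1) * single r s 1 - X * (β (single s r 1) * single r s 1) := by
    intro s
    rw [hβ]
    noncomm_ring
  have hswap : ∑ s, β (X * single s r 1) * single r s 1
      = (∑ s, β (single s r 1) * single r s 1) * X := by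
    simp only [hexp, map_sum, map_smul, Finset.sum_mul, smul_mul_assoc, mul_assoc, hrow,
      Finset.mul_sum, mul_smul_comm]
    exact Finset.sum_comm
  rw [hX, Finset.sum_congr rfl fun s _ => hterm s, Finset.sum_sub_distrib, hswap,
    ← Finset.mul_sum]
  noncomm_ring

/-- A matrix commuting with everything is a scalar. -/
theorem exists_eq_smul_one_of_forall_commute (C : Matrix n n ℂ) (hC : ∀ M, M * C = C * M) :
    ∃ c : ℂ, C = c • 1 := by
  obtain ⟨c, hc⟩ := mem_range_scalar_iff_commute_single.2
    fun i j _ => (hC (single i j 1) : Commute (single i j 1) C)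
  exact ⟨c, by rw [← hc, scalar_apply, smul_one_eq_diagonal]⟩

theorem sum_ofFn_cons [Fintype ι] {M : Type*} [AddCommMonoid M] (m : ℕ) (f : List ι → M) :
    ∑ p : Fin (m + 1) → ι, f (List.ofFn p) = ∑ i, ∑ p : Fin m → ι, f (i :: List.ofFn p) := by
  rw [← (Fin.consEquiv fun _ => ι).sum_comp, Fintype.sum_prod_type]
  simp [Fin.consEquiv]

theorem sum_ofFn_concat [Fintype ι] {M : Type*} [AddCommMonoid M] (m : ℕ) (f : List ι → M) :
    ∑ p : Fin (m + 1) → ι, f (List.ofFn p) = ∑ p : Fin m → ι, ∑ i, f (List.ofFn p ++ [i]) := by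
  rw [← (Fin.snocEquiv fun _ => ι).sum_comp, Fintype.sum_prod_type_right]
  simp [Fin.snocEquiv, List.ofFn_succ', -List.ofFn_succ]

/-- Linear maps out of the matrix algebra are determined by word products of length `L`. -/
def WordsSpan (A : ι → Matrix n n ℂ) (L : ℕ) : Prop :=
  Submodule.span ℂ (Set.range fun w : Fin L → ι => wordProd A (List.ofFn w)) = ⊤

theorem WordsSpan.induction {A : ι → Matrix n n ℂ} {L : ℕ} (h : WordsSpan A L)
    {P : Matrix n n ℂ → Prop} (word : ∀ w : List ι, w.length = L → P (wordProd A w))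
    (add : ∀ M N, P M → P N → P (M + N)) (smul : ∀ (c : ℂ) M, P M → P (c • M))
    (zero : P 0) (M : Matrix n n ℂ) : P M := by
  have hM : M ∈ Submodule.span ℂ (Set.range fun w : Fin L → ι => wordProd A (List.ofFn w)) :=
    h ▸ Submodule.mem_top
  induction hM using Submodule.span_induction with
  | mem x hx => obtain ⟨w, rfl⟩ := hx; exact word _ (by simp)
  | zero => exact zero
  | add x y _ _ hx hy => exact add x y hx hy
  | smul c x _ hx => exact smul c x hx

theorem cons_append_eq_of_append_singleton_eq {p l : List ι} {i y : ι} (h : p ++ [i] = y :: l)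
    (r : List ι) : p ++ i :: r = y :: (l ++ r) := by
  rw [← List.cons_append, ← h, List.append_assoc, List.singleton_append]

section Exchange

variable {A : ι → Matrix n n ℂ} {k : ℕ}
  {Δ : List ι → List ι → Matrix n n ℂ →ₗ[ℂ] Matrix n n ℂ}

theorem exchange_words
    (hΔ : ∀ (p p' q q' : List ι) (i j y y' : ι), p.length = k → p'.length = k →
      q.length = k → q'.length = k → p ++ [i] = y :: p' → j :: q = q' ++ [y'] →
      ∀ X, A y * Δ p' q (X * A j) = Δ p q' (A i * X) * A y')
    {p' q : List ι} (hp' : p'.length = k) (hq : q.length = k) :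
    ∀ (m : ℕ) (i j y y' p q' : List ι), i.length = m → j.length = m →
      p.length = k → q'.length = k → p ++ i = y ++ p' → j ++ q = q' ++ y' →
      ∀ X, wordProd A y * Δ p' q (X * wordProd A j)
        = Δ p q' (wordProd A i * X) * wordProd A y' := by
  intro m
  induction m with
  | zero =>
    intro i j y y' p q' hi hj hp hq' h h' X
    obtain rfl := List.length_eq_zero_iff.1 hi
    obtain rfl := List.length_eq_zero_iff.1 hj
    have h1 := congrArg List.length h
    have h2 := congrArg List.length h'
    simp only [List.length_append, List.length_nil] at h1 h2
    obtain rfl : y = [] := List.length_eq_zero_iff.1 (by lia)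
    obtain rfl : y' = [] := List.length_eq_zero_iff.1 (by lia)
    simp only [List.nil_append, List.append_nil] at h h'
    simp [h, h']
  | succ m ih =>
    intro i j y y' p q' hi hj hp hq' h h' X
    have h1 := congrArg List.length h
    have h2 := congrArg List.length h'
    simp only [List.length_append] at h1 h2
    obtain ⟨i₁, i₂, rfl⟩ := List.exists_cons_of_length_eq_add_one hi
    obtain ⟨j₁, j₂, rfl⟩ := List.exists_cons_of_length_eq_add_one hj
    obtain ⟨y₁, y₂, rfl⟩ : ∃ a l, y = a :: l :=
      List.exists_cons_of_length_eq_add_one (n := m) (by lia)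
    obtain ⟨z₁, z₂, rfl⟩ : ∃ a l, y' = a :: l :=
      List.exists_cons_of_length_eq_add_one (n := m) (by lia)
    obtain ⟨y₀, p₁, hp₁⟩ : ∃ a l, p ++ [i₁] = a :: l :=
      List.exists_cons_of_length_eq_add_one (n := k) (by simp [hp])
    obtain ⟨j₀, q₁, hq₁⟩ : ∃ a l, q' ++ [z₁] = a :: l :=
      List.exists_cons_of_length_eq_add_one (n := k) (by simp [hq'])
    have hp₁k : p₁.length = k := by simpa [hp] using (congrArg List.length hp₁).symm
    have hq₁k : q₁.length = k := by simpa [hq'] using (congrArg List.length hq₁).symm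
    rw [cons_append_eq_of_append_singleton_eq hp₁, List.cons_append, List.cons.injEq] at h
    rw [cons_append_eq_of_append_singleton_eq hq₁, List.cons_append, List.cons.injEq] at h'
    obtain ⟨rfl, h⟩ := h
    obtain ⟨rfl, h'⟩ := h'
    have hrec := ih i₂ j₂ y₂ z₂ p₁ q₁ (by simpa using hi) (by simpa using hj) hp₁k hq₁k h h'
      (X * A j₁)
    have hone := hΔ p p₁ q₁ q' i₁ j₁ y₀ z₁ hp hp₁k hq₁k hq' hp₁ hq₁.symm (wordProd A i₂ * X)
    simp only [wordProd_cons, mul_assoc] at hrec hone ⊢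
    rw [hrec, ← mul_assoc, hone, mul_assoc]

variable {L : ℕ}

theorem exchange_matrices (hspan : WordsSpan A L)
    (hΔ : ∀ (p p' q q' : List ι) (i j y y' : ι), p.length = k → p'.length = k →
      q.length = k → q'.length = k → p ++ [i] = y :: p' → j :: q = q' ++ [y'] →
      ∀ X, A y * Δ p' q (X * A j) = Δ p q' (A i * X) * A y')
    {p p' q q' : List ι} (hp : p.length = k) (hp' : p'.length = k) (hq : q.length = k)
    (hq' : q'.length = k) (M N X : Matrix n n ℂ) :
    wordProd A p * M * Δ p' q (X * wordProd A q' * N)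
      = Δ p q' (M * wordProd A p' * X) * N * wordProd A q := by
  induction M using hspan.induction with
  | zero => simp
  | add M M' h h' => simp only [mul_add, add_mul, map_add, h, h']
  | smul c M h => simp only [mul_smul_comm, smul_mul_assoc, map_smul, h]
  | word i hi =>
    induction N using hspan.induction with
    | zero => simp
    | add N N' h h' => simp only [mul_add, add_mul, map_add, h, h']
    | smul c N h => simp only [mul_smul_comm, smul_mul_assoc, map_smul, h]
    | word j hj =>
      have := exchange_words hΔ hp' hq (L + k) (i ++ p') (q' ++ j) (p ++ i) (j ++ q) p q'
        (by simp [hi, hp']) (by simp [hj, hq', add_comm]) hp hq' (by simp) (by simp) X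
      simpa only [wordProd_append, mul_assoc] using this

variable [Fintype ι] {Y Z : List ι → Matrix n n ℂ}

theorem eq_of_wordProd_mul_eq
    (hZ : ∑ p : Fin k → ι, Z (List.ofFn p) * wordProd A (List.ofFn p) = 1)
    {M N : Matrix n n ℂ} (h : ∀ p : List ι, p.length = k → wordProd A p * M = wordProd A p * N) :
    M = N := by
  rw [← one_mul M, ← one_mul N, ← hZ]
  simp only [Finset.sum_mul, mul_assoc]
  exact Finset.sum_congr rfl fun p _ => by rw [h _ (by simp)]

theorem eq_of_mul_wordProd_eq
    (hY : ∑ p : Fin k → ι, wordProd A (List.ofFn p) * Y (List.ofFn p) = 1)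
    {M N : Matrix n n ℂ} (h : ∀ p : List ι, p.length = k → M * wordProd A p = N * wordProd A p) :
    M = N := by
  rw [← mul_one M, ← mul_one N, ← hY]
  simp only [Finset.mul_sum, ← mul_assoc]
  exact Finset.sum_congr rfl fun p _ => by rw [h _ (by simp)]

theorem exists_scalar_of_exchange (hspan : WordsSpan A L)
    (hZ : ∑ p : Fin k → ι, Z (List.ofFn p) * wordProd A (List.ofFn p) = 1)
    (hY : ∑ p : Fin k → ι, wordProd A (List.ofFn p) * Y (List.ofFn p) = 1)
    (hΔ : ∀ (p p' q q' : List ι) (i j y y' : ι), p.length = k → p'.length = k →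
      q.length = k → q'.length = k → p ++ [i] = y :: p' → j :: q = q' ++ [y'] →
      ∀ X, A y * Δ p' q (X * A j) = Δ p q' (A i * X) * A y') :
    ∃ c : ℂ, ∀ p q : List ι, p.length = k → q.length = k → ∀ X,
      Δ p q X = c • (wordProd A p * X * wordProd A q) := by
  let H : Matrix n n ℂ →ₗ[ℂ] Matrix n n ℂ := ∑ p : Fin k → ι, ∑ q : Fin k → ι,
    LinearMap.mulLeft ℂ (Z (List.ofFn p)) ∘ₗ LinearMap.mulRight ℂ (Y (List.ofFn q)) ∘ₗ
      Δ (List.ofFn p) (List.ofFn q)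
  have hleft : ∀ p' q : List ι, p'.length = k → q.length = k → ∀ M N,
      M * Δ p' q N = H (M * wordProd A p') * N * wordProd A q := by
    intro p' q hp' hq M N
    have hterm : ∀ p q' : Fin k → ι,
        Z (List.ofFn p) * wordProd A (List.ofFn p) *
            (M * Δ p' q (wordProd A (List.ofFn q') * Y (List.ofFn q') * N))
          = Z (List.ofFn p) * (Δ (List.ofFn p) (List.ofFn q') (M * wordProd A p')
              * Y (List.ofFn q')) * N * wordProd A q := by
      intro p q'
      have := exchange_matrices hspan hΔ (p := List.ofFn p) (q' := List.ofFn q') (by simp) hp' hq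
        (by simp) M (Y (List.ofFn q') * N) 1
      simp only [one_mul, mul_one, mul_assoc] at this ⊢
      rw [this]
    calc M * Δ p' q N
        = (∑ p : Fin k → ι, Z (List.ofFn p) * wordProd A (List.ofFn p)) * (M * Δ p' q
            ((∑ q' : Fin k → ι, wordProd A (List.ofFn q') * Y (List.ofFn q')) * N)) := by
          rw [hZ, hY, one_mul, one_mul]
      _ = _ := by
          simp only [Finset.sum_mul, map_sum, Finset.mul_sum, hterm, H, LinearMap.sum_apply,
            LinearMap.comp_apply, LinearMap.mulLeft_apply, LinearMap.mulRight_apply]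
          exact Finset.sum_comm
  have hH : ∀ M (p : List ι), p.length = k → H (M * wordProd A p) = M * H (wordProd A p) := by
    intro M p hp
    refine eq_of_mul_wordProd_eq hY fun q hq => ?_
    have h1 := hleft p q hp hq M 1
    have h2 := hleft p q hp hq 1 1
    simp only [one_mul, mul_one] at h1 h2
    rw [← h1, h2, mul_assoc]
  set C := ∑ p : Fin k → ι, Z (List.ofFn p) * H (wordProd A (List.ofFn p)) with hC
  have hHC : ∀ M, H M = M * C := by
    intro M
    conv_lhs => rw [← mul_one M, ← hZ]
    simp only [Finset.mul_sum, map_sum, hC, ← mul_assoc]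
    exact Finset.sum_congr rfl fun p _ => hH _ _ (by simp)
  have hform : ∀ p q : List ι, p.length = k → q.length = k → ∀ X,
      Δ p q X = wordProd A p * C * X * wordProd A q := by
    intro p q hp hq X
    simpa [hHC] using hleft p q hp hq 1 X
  have hcomm : ∀ M, M * C = C * M := by
    have key : ∀ M (p' : List ι), p'.length = k →
        M * wordProd A p' * C = C * (M * wordProd A p') := by
      intro M p' hp'
      refine eq_of_wordProd_mul_eq hZ fun p hp => eq_of_mul_wordProd_eq hY fun q' hq' =>
        eq_of_mul_wordProd_eq hY fun q hq => ?_
      have := exchange_matrices hspan hΔ hp hp' hq hq' M 1 1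
      rw [hform _ _ hp' hq, hform _ _ hp hq'] at this
      simpa only [mul_one, one_mul, mul_assoc] using this
    intro M
    have hM : ∑ p : Fin k → ι, M * Z (List.ofFn p) * wordProd A (List.ofFn p) = M := by
      simp only [mul_assoc]
      rw [← Finset.mul_sum, hZ, mul_one]
    rw [← hM, Finset.sum_mul, Finset.mul_sum]
    exact Finset.sum_congr rfl fun p _ => key _ _ (by simp)
  obtain ⟨c, hc⟩ := exists_eq_smul_one_of_forall_commute C hcomm
  refine ⟨c, fun p q hp hq X => ?_⟩
  rw [hform p q hp hq, hc]
  simp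

end Exchange

section Gauge

variable {A : ι → Matrix n n ℂ} {k L : ℕ}

theorem exists_transport_words {h : List ι → Matrix n n ℂ →ₗ[ℂ] Matrix n n ℂ}
    {G : List ι → Matrix n n ℂ}
    (hh : ∀ (p p' : List ι) (i y : ι), p.length = k → p'.length = k → p ++ [i] = y :: p' →
      ∀ X, h p (A i * X) = A y * h p' X + G (p ++ [i]) * X)
    {p' : List ι} (hp' : p'.length = k) :
    ∀ i y p : List ι, p.length = k → p ++ i = y ++ p' →
      ∃ T, ∀ X, h p (wordProd A i * X) = wordProd A y * h p' X + T * X := by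
  intro i
  induction i with
  | nil =>
    intro y p hp hi
    have hlen := congrArg List.length hi
    simp only [List.length_append, List.length_nil] at hlen
    obtain rfl : y = [] := List.length_eq_zero_iff.1 (by lia)
    simp only [List.nil_append, List.append_nil] at hi
    exact ⟨0, fun X => by simp [hi]⟩
  | cons i₁ i₂ ih =>
    intro y p hp hi
    have hlen := congrArg List.length hi
    simp only [List.length_append, List.length_cons] at hlen
    obtain ⟨y₁, y₂, rfl⟩ : ∃ a l, y = a :: l :=
      List.exists_cons_of_length_eq_add_one (n := i₂.length) (by lia)
    obtain ⟨y₀, p₁, hp₁⟩ : ∃ a l, p ++ [i₁] = a :: l :=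
      List.exists_cons_of_length_eq_add_one (n := k) (by simp [hp])
    have hp₁k : p₁.length = k := by simpa [hp] using (congrArg List.length hp₁).symm
    rw [cons_append_eq_of_append_singleton_eq hp₁, List.cons_append, List.cons.injEq] at hi
    obtain ⟨rfl, hi⟩ := hi
    obtain ⟨T, hT⟩ := ih y₂ p₁ hp₁k hi
    refine ⟨A y₀ * T + G (p ++ [i₁]) * wordProd A i₂, fun X => ?_⟩
    rw [wordProd_cons, mul_assoc, hh p p₁ i₁ y₀ hp hp₁k hp₁, hT, wordProd_cons]
    noncomm_ring

variable [Fintype ι] {Y Z : List ι → Matrix n n ℂ}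

theorem exists_gauge_of_transport (hspan : WordsSpan A L)
    (hZ : ∑ p : Fin k → ι, Z (List.ofFn p) * wordProd A (List.ofFn p) = 1)
    {h : List ι → Matrix n n ℂ →ₗ[ℂ] Matrix n n ℂ} {G : List ι → Matrix n n ℂ}
    (hh : ∀ (p p' : List ι) (i y : ι), p.length = k → p'.length = k → p ++ [i] = y :: p' →
      ∀ X, h p (A i * X) = A y * h p' X + G (p ++ [i]) * X) :
    ∃ b : List ι → Matrix n n ℂ, ∀ (p p' : List ι) (i y : ι), p.length = k → p'.length = k →
      p ++ [i] = y :: p' → G (p ++ [i]) = b p * A i - A y * b p' := by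
  have htrans : ∀ p p' : List ι, p.length = k → p'.length = k → ∀ M X,
      h p (M * wordProd A p' * X) = h p (M * wordProd A p') * X
        + wordProd A p * M * (h p' X - h p' 1 * X) := by
    intro p p' hp hp' M X
    induction M using hspan.induction with
    | zero => simp
    | add M N hM hN =>
      simp only [mul_add, add_mul, map_add, hM, hN]
      abel
    | smul c M hM => simp only [mul_smul_comm, smul_mul_assoc, map_smul, hM, smul_add]
    | word i hi =>
      obtain ⟨T, hT⟩ := exists_transport_words hh hp' (i ++ p') (p ++ i) p hp (by simp)
      have h1 := hT 1
      rw [wordProd_append, mul_one, mul_one] at h1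
      have h2 := hT X
      rw [wordProd_append] at h2
      rw [h2, h1, wordProd_append]
      noncomm_ring
  let β : Matrix n n ℂ →ₗ[ℂ] Matrix n n ℂ := ∑ p : Fin k → ι,
    LinearMap.mulLeft ℂ (Z (List.ofFn p)) ∘ₗ
      (h (List.ofFn p) - LinearMap.mulLeft ℂ (h (List.ofFn p) 1))
  have hmul : ∀ p : List ι, p.length = k → ∀ M X,
      h p (M * X) = h p M * X + wordProd A p * M * β X := by
    intro p hp M X
    have hM : ∑ p : Fin k → ι, M * Z (List.ofFn p) * wordProd A (List.ofFn p) = M := by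
      simp only [mul_assoc]
      rw [← Finset.mul_sum, hZ, mul_one]
    calc h p (M * X)
        = ∑ p' : Fin k → ι, h p (M * Z (List.ofFn p') * wordProd A (List.ofFn p') * X) := by
          rw [← map_sum, ← Finset.sum_mul, hM]
      _ = (∑ p' : Fin k → ι, h p (M * Z (List.ofFn p') * wordProd A (List.ofFn p'))) * X
          + wordProd A p * M * β X := by
          rw [Finset.sum_congr rfl fun p' _ => htrans p (List.ofFn p') hp (by simp) _ X,
            Finset.sum_add_distrib, Finset.sum_mul]
          simp [β, Finset.mul_sum, mul_assoc]
      _ = h p M * X + wordProd A p * M * β X := by rw [← map_sum, hM]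
  have hone : ∀ p : List ι, p.length = k → ∀ X, h p X = h p 1 * X + wordProd A p * β X := by
    intro p hp X
    simpa using hmul p hp 1 X
  obtain ⟨B, hB⟩ := exists_eq_commutator_of_leibniz β fun M X => by
    refine eq_of_wordProd_mul_eq hZ fun p hp => ?_
    have h1 := hmul p hp M X
    rw [hone p hp (M * X), hone p hp M] at h1
    have h2 : wordProd A p * β (M * X)
        = (h p 1 * (M * X) + wordProd A p * β (M * X)) - h p 1 * (M * X) := by abel
    rw [h2, h1]
    noncomm_ring
  refine ⟨fun p => h p 1 - wordProd A p * B, fun p p' i y hp hp' hi => ?_⟩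
  have h1 := hh p p' i y hp hp' hi 1
  rw [mul_one, mul_one, hone p hp, hB] at h1
  have h2 := congrArg (wordProd A) hi
  rw [wordProd_append, wordProd_cons, wordProd_cons, wordProd_nil, mul_one] at h2
  rw [eq_sub_of_add_eq' h1.symm]
  simp only [mul_sub, sub_mul, ← mul_assoc, ← h2]
  abel

/-- If the sliding sums of `g` over words of two consecutive lengths are linear in the middle
block, then `g` is, up to a constant, a telescoping difference. -/
theorem exists_const_add_gauge (hspan : WordsSpan A L)
    (hZ : ∑ p : Fin k → ι, Z (List.ofFn p) * wordProd A (List.ofFn p) = 1)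
    (hY : ∑ p : Fin k → ι, wordProd A (List.ofFn p) * Y (List.ofFn p) = 1)
    {D₀ D₁ : List ι → List ι → Matrix n n ℂ →ₗ[ℂ] Matrix n n ℂ} {g : List ι → Matrix n n ℂ}
    (hl : ∀ (p p' q : List ι) (i y : ι), p.length = k → p'.length = k → q.length = k →
      p ++ [i] = y :: p' → ∀ X,
      D₁ p q (A i * X) = A y * D₀ p' q X + g (p ++ [i]) * X * wordProd A q)
    (hr : ∀ (p q q' : List ι) (j y : ι), p.length = k → q.length = k → q'.length = k →
      j :: q = q' ++ [y] → ∀ X,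
      D₁ p q (X * A j) = D₀ p q' X * A y + wordProd A p * X * g (j :: q)) :
    ∃ (c : ℂ) (b : List ι → Matrix n n ℂ), ∀ (p p' : List ι) (i y : ι),
      p.length = k → p'.length = k → p ++ [i] = y :: p' →
      g (p ++ [i]) = c • wordProd A (p ++ [i]) + (b p * A i - A y * b p') := by
  obtain ⟨c, hc⟩ := exists_scalar_of_exchange (A := A) (k := k) (Δ := fun p q => D₁ p q - D₀ p q)
    hspan hZ hY (by
      intro p p' q q' i j y y' hp hp' hq hq' h h' X
      have h1 := hl p p' q i y hp hp' hq h (X * A j)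
      have h2 := hr p' q q' j y' hp' hq hq' h' X
      have h3 := hl p p' q' i y hp hp' hq' h X
      have h4 := hr p q q' j y' hp hq hq' h' (A i * X)
      have ha := congrArg (wordProd A) h
      have ha' := congrArg (wordProd A) h'
      simp only [wordProd_append, wordProd_cons, wordProd_nil, mul_one] at ha ha'
      rw [mul_assoc, h1] at h4
      simp only [LinearMap.sub_apply, h2, h3, mul_sub, sub_mul, mul_add, add_mul]
      simp only [← mul_assoc] at h4 ⊢
      rw [← ha, eq_sub_of_add_eq h4, mul_assoc _ (A j), mul_assoc _ (wordProd A q'), ha']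
      abel)
  let h : List ι → Matrix n n ℂ →ₗ[ℂ] Matrix n n ℂ := fun p => ∑ q : Fin k → ι,
    LinearMap.mulRight ℂ (Y (List.ofFn q)) ∘ₗ D₀ p (List.ofFn q)
  obtain ⟨b, hb⟩ := exists_gauge_of_transport (h := h)
    (G := fun l => g l - c • wordProd A l) hspan hZ (by
      intro p p' i y hp hp' hi X
      have hterm : ∀ q : Fin k → ι, D₀ p (List.ofFn q) (A i * X) * Y (List.ofFn q)
          = A y * (D₀ p' (List.ofFn q) X * Y (List.ofFn q))
            + (g (p ++ [i]) - c • wordProd A (p ++ [i])) * X *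
              (wordProd A (List.ofFn q) * Y (List.ofFn q)) := by
        intro q
        have h1 := hc p (List.ofFn q) hp (by simp) (A i * X)
        rw [LinearMap.sub_apply, hl p p' _ i y hp hp' (by simp) hi] at h1
        rw [← sub_sub_cancel (A y * D₀ p' (List.ofFn q) X
          + g (p ++ [i]) * X * wordProd A (List.ofFn q)) (D₀ p (List.ofFn q) (A i * X)), h1]
        simp only [wordProd_append, wordProd_cons, wordProd_nil, mul_one, sub_mul, add_mul,
          smul_mul_assoc, mul_assoc]
        abel
      simp only [h, LinearMap.sum_apply, LinearMap.comp_apply, LinearMap.mulRight_apply, hterm,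
        Finset.sum_add_distrib, ← Finset.mul_sum, hY, mul_one])
  refine ⟨c, b, fun p p' i y hp hp' hi => ?_⟩
  rw [← hb p p' i y hp hp' hi, add_sub_cancel]

end Gauge

section SlidingSum

/-- `g` on the first `k + 1` letters, `A` on the rest. -/
noncomputable def headInsert (A : ι → Matrix n n ℂ) (g : List ι → Matrix n n ℂ) (k : ℕ)
    (w : List ι) : Matrix n n ℂ :=
  g (w.take (k + 1)) * wordProd A (w.drop (k + 1))

/-- Sum over the positions of a window of length `k + 1` inside the open word `w`. -/
noncomputable def slidingSum (A : ι → Matrix n n ℂ) (g : List ι → Matrix n n ℂ) (k : ℕ)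
    (w : List ι) : Matrix n n ℂ :=
  ∑ r ∈ Finset.range (w.length - k), wordProd A (w.take r) * headInsert A g k (w.drop r)

variable {A : ι → Matrix n n ℂ} {g : List ι → Matrix n n ℂ} {k : ℕ}

theorem headInsert_append {v : List ι} (hv : k + 1 ≤ v.length) (w : List ι) :
    headInsert A g k (v ++ w) = headInsert A g k v * wordProd A w := by
  simp [headInsert, List.take_append_of_le_length hv, List.drop_append_of_le_length hv, mul_assoc]

theorem headInsert_append_of_length_eq {v : List ι} (hv : v.length = k + 1) (w : List ι) :
    headInsert A g k (v ++ w) = g v * wordProd A w := by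
  simp [headInsert, ← hv]

theorem slidingSum_cons {w : List ι} (hw : k ≤ w.length) (x : ι) :
    slidingSum A g k (x :: w) = headInsert A g k (x :: w) + A x * slidingSum A g k w := by
  have hlen : (x :: w).length - k = (w.length - k) + 1 := by simp; lia
  rw [slidingSum, hlen, Finset.sum_range_succ', add_comm]
  simp [slidingSum, Finset.mul_sum, mul_assoc]

theorem slidingSum_concat {v q : List ι} (hq : q.length = k) (x : ι) :
    slidingSum A g k (v ++ q ++ [x])
      = slidingSum A g k (v ++ q) * A x + wordProd A v * g (q ++ [x]) := by
  have hlen : (v ++ q ++ [x]).length - k = ((v ++ q).length - k) + 1 := by simp; lia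
  have hlast : (v ++ q).length - k = v.length := by simp [hq]
  rw [slidingSum, hlen, Finset.sum_range_succ, slidingSum, Finset.sum_mul]
  congr 1
  · refine Finset.sum_congr rfl fun r hr => ?_
    have hr' : r + k < (v ++ q).length := by
      have := Finset.mem_range.1 hr
      lia
    rw [List.take_append_of_le_length (by lia), List.drop_append_of_le_length (by lia),
      headInsert_append (by rw [List.length_drop]; lia)]
    simp [mul_assoc]
  · rw [hlast]
    have : (q ++ [x]).length = k + 1 := by simp [hq]
    simp [headInsert, List.append_assoc, ← this, -List.length_append]

/-- Splitting the cyclic sum over windows into those contained in the stretch `p ++ z ++ q`, and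
the remaining ones, which avoid `z`. -/
theorem sum_headInsert_rotate {p z q : List ι} (hp : p.length = k) (hq : q.length = k)
    (v : List ι) :
    ∑ r ∈ Finset.range (p ++ z ++ q ++ v).length,
        (headInsert A g k ((p ++ z ++ q ++ v).rotate r)).trace
      = (slidingSum A g k (p ++ z ++ q) * wordProd A v).trace
        + ∑ r ∈ Finset.range (k + v.length),
          (headInsert A g k ((q ++ v).drop r ++ p) * wordProd A z
            * wordProd A ((q ++ v).take r)).trace := by
  have hlen : (p ++ z ++ q ++ v).length = (k + z.length) + (k + v.length) := by
    simp [hp, hq]; lia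
  rw [hlen, Finset.sum_range_add]
  congr 1
  · have hlen' : (p ++ z ++ q).length - k = k + z.length := by simp [hp, hq, add_comm]
    rw [slidingSum, hlen', Finset.sum_mul, trace_sum]
    refine Finset.sum_congr rfl fun r hr => ?_
    have hr := Finset.mem_range.1 hr
    have hle : r + k + 1 ≤ (p ++ z ++ q).length := by simp [hp, hq]; lia
    rw [List.rotate_eq_drop_append_take (by lia), List.drop_append_of_le_length (by lia),
      List.take_append_of_le_length (by lia), List.append_assoc,
      headInsert_append (by rw [List.length_drop]; lia), wordProd_append, mul_assoc,
      trace_mul_comm (wordProd A _), mul_assoc]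
  · refine Finset.sum_congr rfl fun r hr => ?_
    have hr := Finset.mem_range.1 hr
    have hsplit : (p ++ z ++ q ++ v).rotate (k + z.length + r)
        = ((q ++ v).drop r ++ p) ++ (z ++ (q ++ v).take r) := by
      rw [← List.rotate_rotate, ← hp, ← List.length_append, List.append_assoc (p ++ z),
        List.rotate_append_length_eq, List.rotate_eq_drop_append_take (by simp [hq]; lia),
        List.drop_append_of_le_length (by simp [hq]; lia),
        List.take_append_of_le_length (by simp [hq]; lia)]
      simp
    rw [hsplit, headInsert_append (by simp [hp, hq]; lia), wordProd_append, mul_assoc]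

/-- If all cyclic window sums vanish, the open sliding sum around a block depends on the block
only through its product, and linearly so. -/
theorem exists_linear_slidingSum {m N l : ℕ}
    (hinj : ∀ M : Matrix n n ℂ, (∀ v : List ι, v.length = m → (M * wordProd A v).trace = 0) →
      M = 0)
    (hN : N = 2 * k + l + m)
    (hcyc : ∀ w : List ι, w.length = N →
      ∑ r ∈ Finset.range N, (headInsert A g k (w.rotate r)).trace = 0) :
    ∃ D : List ι → List ι → Matrix n n ℂ →ₗ[ℂ] Matrix n n ℂ, ∀ p z q : List ι,
      p.length = k → z.length = l → q.length = k →
      D p q (wordProd A z) = slidingSum A g k (p ++ z ++ q) := by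
  let Γ : Matrix n n ℂ →ₗ[ℂ] ((Fin m → ι) → ℂ) :=
    { toFun := fun M v => (M * wordProd A (List.ofFn v)).trace
      map_add' := fun M N => by ext v; simp [add_mul]
      map_smul' := fun c M => by ext v; simp }
  obtain ⟨S, hS⟩ := Γ.exists_leftInverse_of_injective <| LinearMap.ker_eq_bot'.2 fun M hM =>
    hinj M fun v hv => by
      subst hv
      simpa [Γ] using congrFun hM v.get
  let Ψ : List ι → List ι → Matrix n n ℂ →ₗ[ℂ] ((Fin m → ι) → ℂ) := fun p q =>
    { toFun := fun X v => ∑ r ∈ Finset.range (k + m),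
        (headInsert A g k ((q ++ List.ofFn v).drop r ++ p) * X
          * wordProd A ((q ++ List.ofFn v).take r)).trace
      map_add' := fun X Y => by ext v; simp [add_mul, mul_add, Finset.sum_add_distrib]
      map_smul' := fun c X => by ext v; simp [Finset.mul_sum] }
  refine ⟨fun p q => -(S ∘ₗ Ψ p q), fun p z q hp hz hq => ?_⟩
  have hΓ : Γ (slidingSum A g k (p ++ z ++ q)) = -Ψ p q (wordProd A z) := by
    ext v
    have hlen : (p ++ z ++ q ++ List.ofFn v).length = N := by simp [hp, hq, hz, hN]; lia
    have h1 := sum_headInsert_rotate (A := A) (g := g) (z := z) hp hq (List.ofFn v)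
    rw [hlen, hcyc _ hlen, List.length_ofFn] at h1
    exact eq_neg_of_add_eq_zero_left h1.symm
  rw [← LinearMap.id_apply (R := ℂ) (slidingSum A g k (p ++ z ++ q)), ← hS, LinearMap.comp_apply,
    hΓ, map_neg]
  rfl

theorem trace_wordProd_rotate (w : List ι) (r : ℕ) :
    (wordProd A (w.rotate r)).trace = (wordProd A w).trace := by
  induction r generalizing w with
  | zero => simp
  | succ r ih =>
    cases w with
    | nil => simp
    | cons x w => rw [List.rotate_cons_succ, ih, wordProd_append, trace_mul_comm]; simp

theorem trace_headInsert_of_gauge {c : ℂ} {b : List ι → Matrix n n ℂ}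
    (hg : ∀ (p p' : List ι) (i y : ι), p.length = k → p'.length = k → p ++ [i] = y :: p' →
      g (p ++ [i]) = c • wordProd A (p ++ [i]) + (b p * A i - A y * b p'))
    {w : List ι} (hw : k + 1 ≤ w.length) :
    (headInsert A g k w).trace = c * (wordProd A w).trace
      - ((b ((w.rotate 1).take k) * wordProd A ((w.rotate 1).drop k)).trace
        - (b (w.take k) * wordProd A (w.drop k)).trace) := by
  obtain ⟨p, v, hp, rfl⟩ : ∃ p v, p.length = k ∧ w = p ++ v :=
    ⟨w.take k, w.drop k, by simp; lia, (List.take_append_drop k w).symm⟩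
  obtain ⟨i, u, rfl⟩ : ∃ i u, v = i :: u := by
    cases v with
    | nil => simp at hw; lia
    | cons i u => exact ⟨i, u, rfl⟩
  obtain ⟨y, p', hi⟩ : ∃ a l, p ++ [i] = a :: l :=
    List.exists_cons_of_length_eq_add_one (n := k) (by simp [hp])
  have hp' : p'.length = k := by simpa [hp] using (congrArg List.length hi).symm
  have hrot : (p ++ i :: u).rotate 1 = p' ++ (u ++ [y]) := by
    rw [cons_append_eq_of_append_singleton_eq hi]
    simp
  have hhead : headInsert A g k (p ++ i :: u) = g (p ++ [i]) * wordProd A u := by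
    rw [← headInsert_append_of_length_eq (A := A) (k := k) (v := p ++ [i]) (by simp [hp])]
    simp
  rw [hrot, hhead, hg p p' i y hp hp' hi]
  have h1 : (p' ++ (u ++ [y])).take k = p' := by simp [← hp']
  have h2 : (p' ++ (u ++ [y])).drop k = u ++ [y] := by simp [← hp']
  have h3 : (p ++ i :: u).take k = p := by simp [← hp]
  have h4 : (p ++ i :: u).drop k = i :: u := by simp [← hp]
  rw [h1, h2, h3, h4]
  simp only [wordProd_append, wordProd_cons, wordProd_nil, mul_one, add_mul, sub_mul,
    smul_mul_assoc, trace_add, trace_sub, trace_smul, smul_eq_mul, mul_assoc]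
  rw [trace_mul_comm (A y), mul_assoc]
  ring

/-- For an injective tensor, vanishing of all cyclic window sums of `g` forces `g` to be a
telescoping difference. -/
theorem exists_gauge_of_cyclic_sum_eq_zero [Fintype ι] [Nonempty n] {L N : ℕ}
    {Y Z : List ι → Matrix n n ℂ} (hspan : WordsSpan A L)
    (hinj : ∀ m, L ≤ m → ∀ M : Matrix n n ℂ,
      (∀ v : List ι, v.length = m → (M * wordProd A v).trace = 0) → M = 0)
    (hZ : ∑ p : Fin k → ι, Z (List.ofFn p) * wordProd A (List.ofFn p) = 1)
    (hY : ∑ p : Fin k → ι, wordProd A (List.ofFn p) * Y (List.ofFn p) = 1)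
    (hN : 2 * L + 2 * k + 1 ≤ N)
    (hcyc : ∀ w : List ι, w.length = N →
      ∑ r ∈ Finset.range N, (headInsert A g k (w.rotate r)).trace = 0) :
    ∃ b : List ι → Matrix n n ℂ, ∀ (p p' : List ι) (i y : ι), p.length = k → p'.length = k →
      p ++ [i] = y :: p' → g (p ++ [i]) = b p * A i - A y * b p' := by
  obtain ⟨D₀, hD₀⟩ := exists_linear_slidingSum (l := L) (m := N - 2 * k - L)
    (hinj _ (by lia)) (by lia) hcyc
  obtain ⟨D₁, hD₁⟩ := exists_linear_slidingSum (l := L + 1) (m := N - 2 * k - (L + 1))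
    (hinj _ (by lia)) (by lia) hcyc
  obtain ⟨c, b, hb⟩ := exists_const_add_gauge (D₀ := D₀) (D₁ := D₁) (g := g) hspan hZ hY
    (by
      intro p p' q i y hp hp' hq hi X
      induction X using hspan.induction with
      | zero => simp
      | add M M' h h' => simp only [mul_add, add_mul, map_add, h, h']; abel
      | smul c M h => simp only [mul_smul_comm, smul_mul_assoc, map_smul, h, smul_add]
      | word z hz =>
        have hw : p ++ (i :: z) ++ q = y :: (p' ++ z ++ q) := by
          rw [cons_append_eq_of_append_singleton_eq hi, List.cons_append]
        have hw' : y :: (p' ++ z ++ q) = (p ++ [i]) ++ (z ++ q) := by simp [hi]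
        rw [← wordProd_cons, hD₁ p (i :: z) q hp (by simp [hz]) hq, hD₀ p' z q hp' hz hq, hw,
          slidingSum_cons (by simp [hp']), hw',
          headInsert_append_of_length_eq (by simp [hp]), wordProd_append, mul_assoc, add_comm])
    (by
      intro p q q' j y hp hq hq' hj X
      induction X using hspan.induction with
      | zero => simp
      | add M M' h h' => simp only [mul_add, add_mul, map_add, h, h']; abel
      | smul c M h => simp only [mul_smul_comm, smul_mul_assoc, map_smul, h, smul_add]
      | word z hz =>
        have hw : p ++ (z ++ [j]) ++ q = (p ++ z) ++ q' ++ [y] := by simp [hj]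
        have hz' : wordProd A z * A j = wordProd A (z ++ [j]) := by simp
        rw [hz', hD₁ p (z ++ [j]) q hp (by simp [hz]) hq, hD₀ p z q' hp hz hq', hw,
          slidingSum_concat hq', wordProd_append, hj])
  have hc : c = 0 := by
    by_contra hc
    refine one_ne_zero (hinj N (by lia) (1 : Matrix n n ℂ) fun w hw => ?_)
    have hsum := hcyc w hw
    rw [Finset.sum_congr rfl fun r _ =>
      trace_headInsert_of_gauge hb (w := w.rotate r) (by simp; lia)] at hsum
    simp only [List.rotate_rotate, trace_wordProd_rotate] at hsum
    rw [Finset.sum_sub_distrib, Finset.sum_range_sub fun r =>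
      (b ((w.rotate r).take k) * wordProd A ((w.rotate r).drop k)).trace] at hsum
    have hN0 : (N : ℂ) ≠ 0 := Nat.cast_ne_zero.2 (by lia)
    subst hw
    simpa [hc, hN0] using hsum
  subst hc
  exact ⟨b, fun p p' i y hp hp' hi => by simpa using hb p p' i y hp hp' hi⟩

end SlidingSum

section FixedPoints

variable [Fintype ι] {A : ι → Matrix n n ℂ} {ρ ρL ρR : Matrix n n ℂ}

theorem sum_wordProd_left (h : ∑ i, (A i)ᴴ * ρ * A i = ρ) (m : ℕ) :
    ∑ p : Fin m → ι, (wordProd A (List.ofFn p))ᴴ * ρ * wordProd A (List.ofFn p) = ρ := by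
  induction m with
  | zero => simp
  | succ m ih =>
    rw [sum_ofFn_cons m fun w => (wordProd A w)ᴴ * ρ * wordProd A w, Finset.sum_comm]
    conv_rhs => rw [← ih]
    refine Finset.sum_congr rfl fun p _ => ?_
    conv_rhs => rw [← h]
    simp [Finset.mul_sum, Finset.sum_mul, mul_assoc]

theorem sum_wordProd_right (h : ∑ i, A i * ρ * (A i)ᴴ = ρ) (m : ℕ) :
    ∑ p : Fin m → ι, wordProd A (List.ofFn p) * ρ * (wordProd A (List.ofFn p))ᴴ = ρ := by
  induction m with
  | zero => simp
  | succ m ih =>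
    rw [sum_ofFn_cons m fun w => wordProd A w * ρ * (wordProd A w)ᴴ]
    conv_rhs => rw [← h]
    refine Finset.sum_congr rfl fun i _ => ?_
    conv_rhs => rw [← ih]
    simp [Finset.mul_sum, Finset.sum_mul, mul_assoc]

theorem exists_left_resolution (hρ : IsUnit ρ) (h : ∑ i, (A i)ᴴ * ρ * A i = ρ) (m : ℕ) :
    ∃ Z : List ι → Matrix n n ℂ,
      ∑ p : Fin m → ι, Z (List.ofFn p) * wordProd A (List.ofFn p) = 1 := by
  refine ⟨fun w => ρ⁻¹ * ((wordProd A w)ᴴ * ρ), ?_⟩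
  simp only [mul_assoc ρ⁻¹]
  rw [← Finset.mul_sum, sum_wordProd_left h, nonsing_inv_mul _ ((isUnit_iff_isUnit_det _).1 hρ)]

theorem exists_right_resolution (hρ : IsUnit ρ) (h : ∑ i, A i * ρ * (A i)ᴴ = ρ) (m : ℕ) :
    ∃ Y : List ι → Matrix n n ℂ,
      ∑ p : Fin m → ι, wordProd A (List.ofFn p) * Y (List.ofFn p) = 1 := by
  refine ⟨fun w => ρ * (wordProd A w)ᴴ * ρ⁻¹, ?_⟩
  simp only [← mul_assoc]
  rw [← Finset.sum_mul, sum_wordProd_right h, mul_nonsing_inv _ ((isUnit_iff_isUnit_det _).1 hρ)]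

/-- A telescoping difference has vanishing expectation in the fixed-point environment. -/
theorem sum_trace_gauge_eq_zero (hL : ∑ i, (A i)ᴴ * ρL * A i = ρL)
    (hR : ∑ i, A i * ρR * (A i)ᴴ = ρR) {k : ℕ} {g b : List ι → Matrix n n ℂ}
    (hg : ∀ (p p' : List ι) (i y : ι), p.length = k → p'.length = k → p ++ [i] = y :: p' →
      g (p ++ [i]) = b p * A i - A y * b p') :
    ∑ s : Fin (k + 1) → ι,
      (ρL * g (List.ofFn s) * ρR * (wordProd A (List.ofFn s))ᴴ).trace = 0 := by
  let f₁ : List ι → ℂ := fun s =>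
    (ρL * (b (s.take k) * wordProd A (s.drop k)) * ρR * (wordProd A s)ᴴ).trace
  let f₂ : List ι → ℂ := fun s =>
    (ρL * (wordProd A (s.take 1) * b (s.drop 1)) * ρR * (wordProd A s)ᴴ).trace
  have hsplit : ∀ s : Fin (k + 1) → ι,
      (ρL * g (List.ofFn s) * ρR * (wordProd A (List.ofFn s))ᴴ).trace
        = f₁ (List.ofFn s) - f₂ (List.ofFn s) := by
    intro s
    have hs := List.ofFn_succ' s
    rw [List.concat_eq_append] at hs
    have hg' := hg (List.ofFn fun i => s i.castSucc) (List.ofFn fun i => s i.succ) (s (Fin.last k))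
      (s 0) (by simp) (by simp) (by rw [← hs, List.ofFn_succ])
    have h1 : (List.ofFn s).take k = List.ofFn fun i => s i.castSucc := by
      rw [hs, List.take_left' (by simp)]
    have h2 : (List.ofFn s).drop k = [s (Fin.last k)] := by
      rw [hs, List.drop_left' (by simp)]
    have h3 : (List.ofFn s).take 1 = [s 0] := by simp [List.ofFn_succ]
    have h4 : (List.ofFn s).drop 1 = List.ofFn fun i => s i.succ := by simp [List.ofFn_succ]
    simp only [f₁, f₂, h1, h2, h3, h4, wordProd_cons, wordProd_nil, mul_one]
    rw [← trace_sub, ← sub_mul, ← sub_mul, ← mul_sub, ← hg', ← hs]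
  have h₁ : ∑ s : Fin (k + 1) → ι, f₁ (List.ofFn s) = ∑ p : Fin k → ι,
      (ρL * b (List.ofFn p) * ρR * (wordProd A (List.ofFn p))ᴴ).trace := by
    rw [sum_ofFn_concat]
    refine Finset.sum_congr rfl fun p _ => ?_
    conv_rhs => rw [← hR]
    simp [f₁, List.take_left', List.drop_left', Finset.mul_sum, Finset.sum_mul, trace_sum,
      mul_assoc]
  have h₂ : ∑ s : Fin (k + 1) → ι, f₂ (List.ofFn s) = ∑ p : Fin k → ι,
      (ρL * b (List.ofFn p) * ρR * (wordProd A (List.ofFn p))ᴴ).trace := by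
    rw [sum_ofFn_cons, Finset.sum_comm]
    refine Finset.sum_congr rfl fun p _ => ?_
    conv_rhs => rw [← hL]
    simp only [f₂, Finset.sum_mul, trace_sum]
    refine Finset.sum_congr rfl fun i _ => ?_
    simp only [List.take_succ_cons, List.take_zero, List.drop_succ_cons, List.drop_zero,
      wordProd_cons, wordProd_nil, mul_one, conjTranspose_mul, mul_assoc]
    rw [trace_mul_comm (A i)ᴴ]
    simp only [mul_assoc]
  rw [Finset.sum_congr rfl fun s _ => hsplit s, Finset.sum_sub_distrib, h₁, h₂, sub_self]

end FixedPoints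

theorem InjectiveLen.eq_zero {d D L m : ℕ} {A : Fin d → Matrix (Fin D) (Fin D) ℂ}
    (hinj : InjectiveLen A L) {Z : List (Fin d) → Matrix (Fin D) (Fin D) ℂ} (hm : L ≤ m)
    (hZ : ∑ p : Fin (m - L) → Fin d, Z (List.ofFn p) * wordProd A (List.ofFn p) = 1)
    {M : Matrix (Fin D) (Fin D) ℂ}
    (hM : ∀ v : List (Fin d), v.length = m → (M * wordProd A v).trace = 0) : M = 0 := by
  refine eq_of_wordProd_mul_eq hZ fun p hp => hinj (funext fun i => ?_)
  have h := hM (List.ofFn i ++ p) (by simp [hp, hm])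
  rw [wordProd_append, ← mul_assoc, trace_mul_comm, ← mul_assoc] at h
  simpa [prodA_eq_wordProd] using h

theorem InjectiveLen.wordsSpan {d D L : ℕ} {A : Fin d → Matrix (Fin D) (Fin D) ℂ}
    (hinj : InjectiveLen A L) : WordsSpan A L := by
  by_contra hne
  obtain ⟨f, hf, hker⟩ := Submodule.exists_le_ker_of_lt_top _ (lt_top_iff_ne_top.2 hne)
  let C : Matrix (Fin D) (Fin D) ℂ := of fun s t => f (single t s 1)
  have hfC : ∀ X, f X = (C * X).trace := by
    intro X
    conv_lhs => rw [matrix_eq_sum_single X]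
    simp only [map_sum, trace, diag_apply, mul_apply, C, of_apply]
    rw [Finset.sum_comm]
    refine Finset.sum_congr rfl fun s _ => Finset.sum_congr rfl fun t _ => ?_
    rw [← mul_one (X t s), ← smul_eq_mul, ← smul_single, map_smul, smul_eq_mul, smul_eq_mul,
      mul_one, mul_comm]
  have hC : C = 0 := hinj (funext fun i => by
    have : f (wordProd A (List.ofFn i)) = 0 := hker (Submodule.subset_span ⟨i, rfl⟩)
    simpa [prodA_eq_wordProd, hfC] using this)
  exact hf (LinearMap.ext fun X => by simp [hfC, hC])

section Chain

variable {d D k N : ℕ}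

theorem rotate_ofFn (x : Fin N → Fin d) (r : Fin N) :
    (List.ofFn x).rotate r = List.ofFn fun t : Fin N => x (cyc r t) := by
  refine List.ext_getElem (by simp) fun t h₁ h₂ => ?_
  simp [List.getElem_rotate, cyc, add_comm]

theorem cyc_sub (r m : Fin N) : cyc r ((m + (N - r)) % N) = m := by
  ext
  have hr := r.isLt
  have hm := m.isLt
  simp only [cyc, Nat.add_mod_mod]
  rw [show (r : ℕ) + (m + (N - r)) = m + N by lia, Nat.add_mod_right, Nat.mod_eq_of_lt hm]

theorem cyc_inj (r : Fin N) {s t : ℕ} (hs : s < N) (ht : t < N) (h : cyc r s = cyc r t) :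
    s = t := by
  have h' : (r + s) % N = (r + t) % N := congrArg Fin.val h
  have : s ≡ t [MOD N] := Nat.ModEq.add_left_cancel' _ h'
  rwa [Nat.ModEq, Nat.mod_eq_of_lt hs, Nat.mod_eq_of_lt ht] at this

/-- Overwrite the window of `k` sites of `w` starting at `r` by `j`. -/
def overwrite (w : Fin N → Fin d) (r : Fin N) (j : Fin k → Fin d) : Fin N → Fin d := fun m =>
  if h : ((m : ℕ) + (N - r)) % N < k then j ⟨_, h⟩ else w m

theorem overwrite_cyc_of_lt (hk : k ≤ N) (w : Fin N → Fin d) (r : Fin N) (j : Fin k → Fin d)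
    (t : Fin k) : overwrite w r j (cyc r t) = j t := by
  have hN : 0 < N := r.pos
  have h : ((cyc r t : ℕ) + (N - r)) % N = t :=
    cyc_inj r (Nat.mod_lt _ hN) (t.isLt.trans_le hk) (cyc_sub r _)
  simp [overwrite, h]

theorem overwrite_of_forall_ne (w : Fin N → Fin d) (r : Fin N) (j : Fin k → Fin d) {m : Fin N}
    (hm : ∀ t : Fin k, m ≠ cyc r t) : overwrite w r j m = w m :=
  dif_neg fun h => hm ⟨_, h⟩ (cyc_sub r m).symm

theorem localOp_mulVec_apply (hk : k ≤ N) (o : Matrix (Fin k → Fin d) (Fin k → Fin d) ℂ)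
    (r : Fin N) (ψ : (Fin N → Fin d) → ℂ) (w : Fin N → Fin d) :
    (localOp o r).mulVec ψ w
      = ∑ j, o (fun t => w (cyc r t)) j * ψ (overwrite w r j) := by
  rw [mulVec, dotProduct]
  refine (Fintype.sum_of_injective (overwrite w r) ?_ _ _ ?_ ?_).symm
  · intro j j' h
    ext t
    rw [← overwrite_cyc_of_lt hk w r j t, h, overwrite_cyc_of_lt hk]
  · intro x hx
    rw [localOp, of_apply, if_neg, mul_zero, zero_mul]
    intro hagree
    refine hx ⟨fun t => x (cyc r t), funext fun m => ?_⟩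
    by_cases hm : ∀ t : Fin k, m ≠ cyc r t
    · rw [overwrite_of_forall_ne w r _ hm, hagree m hm]
    · push Not at hm
      obtain ⟨t, rfl⟩ := hm
      rw [overwrite_cyc_of_lt hk]
  · intro j
    rw [localOp, of_apply, if_pos fun m hm => (overwrite_of_forall_ne w r j hm).symm, mul_one]
    simp only [overwrite_cyc_of_lt hk]

theorem rotate_overwrite (hk : k ≤ N) (w : Fin N → Fin d) (r : Fin N) (j : Fin k → Fin d) :
    (List.ofFn (overwrite w r j)).rotate r
      = List.ofFn j ++ ((List.ofFn w).rotate r).drop k := by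
  rw [rotate_ofFn, rotate_ofFn]
  refine List.ext_getElem (by simp [hk]) fun t h₁ h₂ => ?_
  have ht : t < N := by simpa using h₁
  by_cases htk : t < k
  · rw [List.getElem_append_left (by simpa using htk)]
    simpa using overwrite_cyc_of_lt hk w r j ⟨t, htk⟩
  · rw [List.getElem_append_right (by simpa using htk)]
    have hne : ∀ s : Fin k, cyc r t ≠ cyc r s := fun s h =>
      htk (cyc_inj r ht (s.isLt.trans_le hk) h ▸ s.isLt)
    have hadd : k + (t - k) = t := by lia
    simp [overwrite_of_forall_ne w r j hne, hadd]

/-- The window operator of the energy density: `Σ_j o^i_j A^j - ε A^i`. -/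
noncomputable def windowDefect (A : Fin d → Matrix (Fin D) (Fin D) ℂ)
    (o : Matrix (Fin k → Fin d) (Fin k → Fin d) ℂ) (ε : ℂ) (i : Fin k → Fin d) :
    Matrix (Fin D) (Fin D) ℂ :=
  ∑ j, o i j • wordProd A (List.ofFn j) - ε • wordProd A (List.ofFn i)

theorem trace_headInsert_rotate (A : Fin d → Matrix (Fin D) (Fin D) ℂ) (hk : k + 1 ≤ N)
    (o : Matrix (Fin (k + 1) → Fin d) (Fin (k + 1) → Fin d) ℂ) (ε : ℂ)
    {g : List (Fin d) → Matrix (Fin D) (Fin D) ℂ}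
    (hg : ∀ i, g (List.ofFn i) = windowDefect A o ε i) (r : Fin N) (w : Fin N → Fin d) :
    (headInsert A g k ((List.ofFn w).rotate r)).trace
      = (localOp o r).mulVec (mps A N) w - ε * mps A N w := by
  have htake : ((List.ofFn w).rotate r).take (k + 1)
      = List.ofFn fun t : Fin (k + 1) => w (cyc r t) := by
    rw [rotate_ofFn]
    exact List.ext_getElem (by simp [hk]) fun t h₁ h₂ => by simp [-List.ofFn_succ]
  have hw : mps A N w = (wordProd A (List.ofFn fun t : Fin (k + 1) => w (cyc r t))
      * wordProd A (((List.ofFn w).rotate r).drop (k + 1))).trace := by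
    rw [← htake, ← wordProd_append, List.take_append_drop, trace_wordProd_rotate, mps,
      prodA_eq_wordProd]
  have hj : ∀ j : Fin (k + 1) → Fin d, mps A N (overwrite w r j) = (wordProd A (List.ofFn j)
      * wordProd A (((List.ofFn w).rotate r).drop (k + 1))).trace := by
    intro j
    rw [mps, prodA_eq_wordProd, ← trace_wordProd_rotate _ r, rotate_overwrite hk, wordProd_append]
  rw [localOp_mulVec_apply hk, headInsert, htake, hg, windowDefect, hw]
  simp only [hj, sub_mul, Finset.sum_mul, smul_mul_assoc, trace_sub, trace_sum, trace_smul,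
    smul_eq_mul]

theorem sum_trace_headInsert_rotate_eq_zero {A : Fin d → Matrix (Fin D) (Fin D) ℂ}
    (hk : k + 1 ≤ N) {o : Matrix (Fin (k + 1) → Fin d) (Fin (k + 1) → Fin d) ℂ} {ε : ℂ}
    {g : List (Fin d) → Matrix (Fin D) (Fin D) ℂ}
    (hg : ∀ i, g (List.ofFn i) = windowDefect A o ε i)
    (heig : (opSum (N := N) o).mulVec (mps A N) = ((N : ℂ) * ε) • mps A N)
    {w : List (Fin d)} (hw : w.length = N) :
    ∑ r ∈ Finset.range N, (headInsert A g k (w.rotate r)).trace = 0 := by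
  subst hw
  have h := congrFun heig w.get
  rw [opSum, sum_mulVec, Finset.sum_apply, Pi.smul_apply, smul_eq_mul] at h
  have hterm := fun r : Fin w.length => trace_headInsert_rotate A hk o ε hg r w.get
  simp only [List.ofFn_get] at hterm
  rw [Finset.sum_range, Finset.sum_congr rfl fun r _ => hterm r, Finset.sum_sub_distrib, h]
  simp [mul_assoc]

end Chain

end Words


/-- If an injective MPS (with positive definite transfer fixed
points `ρL, ρR`) on `N > 2L + 2k − 1` sites satisfies `O_N ψ_N = N ε ψ_N`, then
the local expectation value of `o` in the fixed-point environment equals `ε`: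
`Σ_{i,j} o^{i}_{j} Tr(ρL A^{j_1}⋯A^{j_k} ρR (A^{i_k})ᴴ ⋯ (A^{i_1})ᴴ) = ε Tr(ρL ρR)`. -/
theorem local_expectation_eq_energy_density
    (d D : ℕ) (hd : 1 ≤ d) (hD : 1 ≤ D)
    (A : Fin d → Matrix (Fin D) (Fin D) ℂ)
    (L : ℕ) (hinj : InjectiveLen A L)
    (ρL ρR : Matrix (Fin D) (Fin D) ℂ) (hfix : TransferFixedPoints A ρL ρR)
    (k : ℕ) (o : Matrix (Fin (k+1) → Fin d) (Fin (k+1) → Fin d) ℂ)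
    (ε : ℂ) (N : ℕ) (hN : 2 * L + 2 * k + 1 < N)
    (heig : (opSum (N := N) o).mulVec (mps A N) = ((N : ℂ) * ε) • mps A N) :
    ∑ i : Fin (k+1) → Fin d, ∑ j : Fin (k+1) → Fin d,
        o i j * (ρL * prodA A j * ρR *
          ((List.ofFn fun t => (A (i t))ᴴ).reverse).prod).trace
      = ε * (ρL * ρR).trace := by
  obtain ⟨hL, hR, hfixL, hfixR⟩ := hfix
  have : Nonempty (Fin D) := ⟨⟨0, hD⟩⟩
  let g := Function.extend List.ofFn (windowDefect A o ε) 0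
  have hg : ∀ i, g (List.ofFn i) = windowDefect A o ε i :=
    List.ofFn_injective.extend_apply _ _
  obtain ⟨Z, hZ⟩ := exists_left_resolution hL.isUnit hfixL k
  obtain ⟨Y, hY⟩ := exists_right_resolution hR.isUnit hfixR k
  obtain ⟨b, hb⟩ := exists_gauge_of_cyclic_sum_eq_zero (g := g) (N := N) hinj.wordsSpan
    (fun m hm M hM => by
      obtain ⟨Z', hZ'⟩ := exists_left_resolution hL.isUnit hfixL (m - L)
      exact hinj.eq_zero hm hZ' hM)
    hZ hY (by lia) (fun w hw => sum_trace_headInsert_rotate_eq_zero (by lia) hg heig hw)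
  have hzero := sum_trace_gauge_eq_zero hfixL hfixR hb
  have hone : ∑ i : Fin (k + 1) → Fin d,
      (ρL * wordProd A (List.ofFn i) * ρR * (wordProd A (List.ofFn i))ᴴ).trace
        = (ρL * ρR).trace := by
    rw [← trace_sum]
    conv_rhs => rw [← sum_wordProd_right hfixR (k + 1), Finset.mul_sum]
    simp only [mul_assoc]
  have hrev : ∀ i : Fin (k + 1) → Fin d,
      ((List.ofFn fun t => (A (i t))ᴴ).reverse).prod = (wordProd A (List.ofFn i))ᴴ := by
    intro i
    rw [wordProd, conjTranspose_list_prod, List.map_map, List.map_ofFn]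
    rfl
  simp only [hg, windowDefect, mul_sub, sub_mul, trace_sub, Finset.mul_sum, Finset.sum_mul,
    trace_sum, mul_smul_comm, smul_mul_assoc, trace_smul, smul_eq_mul,
    Finset.sum_sub_distrib] at hzero
  rw [← Finset.mul_sum, hone] at hzero
  simp only [hrev, prodA_eq_wordProd]
  exact sub_eq_zero.1 hzero
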